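/- Fix an integer k ≥ 3, δ ∈ (0,1), and A > 0. There exists a constant C > 0, depending only on k, δ and A, such that for all distinct positive integers n, m the following holds. Write φ_{n,m}(x) = (n−m)(x − (n+m)x^k/k) and x₀ = (n+m)^{−1/(k−1)}. If θ : ℝ → [0,1] is a C^∞ function supported in [−x₀/2, x₀(1−δ/2)] ∪ [x₀(1+δ/2), 2] whose derivative satisfies |θ'(x)| ≤ A/x₀ for all x, then |∫_ℝ e(φ_{n,m}(x)) θ(x) dx| ≤ C/|n−m|. -/

import Mathlib

open MeasureTheory

/-- `e z = e^{2πiz}`. -/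
noncomputable def e (t : ℝ) : ℂ := Complex.exp (2 * Real.pi * Complex.I * t)

open Set in
/-- The part of the line which stays away from the stationary point `1`. -/
def nonstationarySet (δ : ℝ) : Set ℝ := Icc (-1 / 2) (1 - δ / 2) ∪ Ici (1 + δ / 2)

lemma isClosed_nonstationarySet (δ : ℝ) : IsClosed (nonstationarySet δ) :=
  isClosed_Icc.union isClosed_Ici

lemma one_add_sq_le_abs_one_sub_pow {p : ℕ} (hp : 2 ≤ p) {δ : ℝ} (hδ0 : 0 < δ) (hδ1 : δ < 1)
    {t : ℝ} (ht : t ∈ nonstationarySet δ) : δ / 4 * (1 + t ^ 2) ≤ |1 - t ^ p| := by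
  rcases ht with ⟨h1, h2⟩ | ht
  · have hq : t ^ p ≤ 1 - δ / 2 := by
      calc t ^ p ≤ |t| ^ p := by rw [← abs_pow]; exact le_abs_self _
        _ ≤ |t| ^ 1 := pow_le_pow_of_le_one (abs_nonneg t) (abs_le.2 ⟨by linarith, by linarith⟩)
            (by omega)
        _ ≤ 1 - δ / 2 := by rw [pow_one]; exact abs_le.2 ⟨by linarith, by linarith⟩
    have ht2 : t ^ 2 ≤ 1 := by nlinarith
    exact le_trans (by nlinarith) (le_abs_self _)
  · have ht' : 1 + δ / 2 ≤ t := ht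
    have hq : t ^ 2 ≤ t ^ p := pow_le_pow_right₀ (by linarith) hp
    have ht2 : 1 + δ ≤ t ^ 2 := by nlinarith
    rw [abs_sub_comm]
    exact le_trans (by nlinarith) (le_abs_self _)

lemma abs_pow_pred_le_abs_one_sub_pow {p : ℕ} (hp : 2 ≤ p) {δ : ℝ} (hδ0 : 0 < δ) (hδ1 : δ < 1)
    {t : ℝ} (ht : t ∈ nonstationarySet δ) : δ / 4 * |t| ^ (p - 1) ≤ |1 - t ^ p| := by
  have hc := one_add_sq_le_abs_one_sub_pow hp hδ0 hδ1 ht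
  rcases ht with ⟨h1, h2⟩ | ht
  · have : |t| ^ (p - 1) ≤ 1 :=
      pow_le_one₀ (abs_nonneg t) (abs_le.2 ⟨by linarith, by linarith⟩)
    nlinarith [sq_nonneg t]
  · have ht' : 1 + δ / 2 ≤ t := ht
    have hq : t ^ 2 ≤ t ^ p := pow_le_pow_right₀ (by linarith) hp
    have hq' : t ^ (p - 1) ≤ t ^ p := pow_le_pow_right₀ (by linarith) (by omega)
    have ht2 : 1 + δ ≤ t ^ 2 := by nlinarith
    rw [abs_sub_comm, abs_of_nonneg (by linarith : (0:ℝ) ≤ t)]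
    exact le_trans (by nlinarith) (le_abs_self _)

lemma one_sub_pow_ne_zero {p : ℕ} (hp : 2 ≤ p) {δ : ℝ} (hδ0 : 0 < δ) (hδ1 : δ < 1)
    {t : ℝ} (ht : t ∈ nonstationarySet δ) : 1 - t ^ p ≠ 0 := by
  have := one_add_sq_le_abs_one_sub_pow hp hδ0 hδ1 ht
  exact abs_pos.1 (lt_of_lt_of_le (by positivity) this)

/-- The amplitude divided by the derivative of the phase has an integrable derivative. -/
lemma exists_hasDerivAt_div_one_sub_pow {p : ℕ} (hp : 2 ≤ p) {δ : ℝ} (hδ0 : 0 < δ) (hδ1 : δ < 1)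
    {A : ℝ} {η : ℝ → ℝ} (hd : Differentiable ℝ η) (hη : ∀ t, |η t| ≤ 1)
    (hs : Function.support η ⊆ nonstationarySet δ) (hη' : ∀ t, |deriv η t| ≤ A) (t : ℝ) :
    ∃ y, HasDerivAt (fun t => η t / (1 - t ^ p)) y t ∧
      |y| ≤ (A * (4 / δ) + p * (4 / δ) ^ 2) * (1 + t ^ 2)⁻¹ := by
  have hA : 0 ≤ A := (abs_nonneg _).trans (hη' 0)
  by_cases ht : t ∈ nonstationarySet δ
  · have hne := one_sub_pow_ne_zero hp hδ0 hδ1 ht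
    have h1 := one_add_sq_le_abs_one_sub_pow hp hδ0 hδ1 ht
    have h2 := abs_pow_pred_le_abs_one_sub_pow hp hδ0 hδ1 ht
    refine ⟨_, (hd t).hasDerivAt.fun_div ((hasDerivAt_pow p t).const_sub 1) hne, ?_⟩
    have hD : 0 < |1 - t ^ p| := abs_pos.2 hne
    set D := |1 - t ^ p| with hDdef
    have hinv : D⁻¹ ≤ 4 / δ * (1 + t ^ 2)⁻¹ := by
      calc D⁻¹ ≤ (δ / 4 * (1 + t ^ 2))⁻¹ := inv_anti₀ (by positivity) h1
        _ = 4 / δ * (1 + t ^ 2)⁻¹ := by rw [mul_inv, inv_div]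
    have h2' : |t| ^ (p - 1) ≤ 4 / δ * D := by
      rw [div_mul_eq_mul_div, le_div_iff₀ hδ0]; linarith
    calc _ ≤ (A * D + 1 * (p * (4 / δ * D))) / D ^ 2 := by
          rw [abs_div, abs_pow, ← hDdef]
          gcongr
          refine (abs_sub _ _).trans ?_
          rw [abs_mul, abs_mul, abs_neg, abs_mul, abs_pow, Nat.abs_cast, ← hDdef]
          gcongr
          · exact hη' t
          · exact hη t
      _ = (A + p * (4 / δ)) * D⁻¹ := by field_simp
      _ ≤ (A + p * (4 / δ)) * (4 / δ * (1 + t ^ 2)⁻¹) := by gcongr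
      _ = _ := by ring
  · refine ⟨0, ?_, by rw [abs_zero]; positivity⟩
    refine (hasDerivAt_const t (0:ℝ)).congr_of_eventuallyEq ?_
    filter_upwards [(isClosed_nonstationarySet δ).isOpen_compl.mem_nhds ht] with s hs'
    rw [Function.notMem_support.1 fun h => hs' (hs h), zero_div]

lemma norm_e (t : ℝ) : ‖e t‖ = 1 := by
  rw [e, show 2 * (Real.pi : ℂ) * Complex.I * t = ((2 * Real.pi * t : ℝ) : ℂ) * Complex.I by
    push_cast; ring, Complex.norm_exp_ofReal_mul_I]

lemma hasDerivAt_e_phase {p : ℕ} (l t : ℝ) :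
    HasDerivAt (fun t : ℝ => e (l * (t - t ^ (p + 1) / ((p + 1 : ℕ) : ℝ))))
      (2 * Real.pi * Complex.I * (l * (1 - t ^ p) : ℝ) *
        e (l * (t - t ^ (p + 1) / ((p + 1 : ℕ) : ℝ)))) t := by
  have h : HasDerivAt (fun t : ℝ => l * (t - t ^ (p + 1) / ((p + 1 : ℕ) : ℝ)))
      (l * (1 - t ^ p)) t := by
    refine (((hasDerivAt_id' t).fun_sub
      ((hasDerivAt_pow (p + 1) t).div_const ((p + 1 : ℕ) : ℝ))).const_mul l).congr_deriv ?_
    rw [Nat.add_sub_cancel, mul_div_cancel_left₀ _ (by positivity)]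
  refine (h.ofReal_comp.const_mul (2 * Real.pi * Complex.I)).cexp.congr_deriv ?_
  rw [e, mul_comm]

/-- Non-stationary phase estimate for the normalized phase `t - t ^ (p + 1) / (p + 1)`. -/
lemma norm_integral_e_phase_mul_le {p : ℕ} (hp : 2 ≤ p) {δ : ℝ} (hδ0 : 0 < δ) (hδ1 : δ < 1)
    {A : ℝ} {η : ℝ → ℝ} (hd : Differentiable ℝ η) (hη : ∀ t, |η t| ≤ 1)
    (hs : Function.support η ⊆ nonstationarySet δ) (hη' : ∀ t, |deriv η t| ≤ A)
    (hc : HasCompactSupport η) {l : ℝ} (hl : l ≠ 0) :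
    ‖∫ t : ℝ, e (l * (t - t ^ (p + 1) / ((p + 1 : ℕ) : ℝ))) * (η t : ℂ)‖
      ≤ (A * (4 / δ) + p * (4 / δ) ^ 2) / |l| := by
  set K := A * (4 / δ) + p * (4 / δ) ^ 2
  choose h' hh hb using exists_hasDerivAt_div_one_sub_pow hp hδ0 hδ1 hd hη hs hη'
  set h : ℝ → ℝ := fun t => η t / (1 - t ^ p) with hdef
  set E : ℝ → ℂ := fun t => e (l * (t - t ^ (p + 1) / ((p + 1 : ℕ) : ℝ)))
  have hE : ∀ t, HasDerivAt E (2 * Real.pi * Complex.I * (l * (1 - t ^ p) : ℝ) * E t) t :=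
    fun t => hasDerivAt_e_phase l t
  have hEc : Continuous E := continuous_iff_continuousAt.2 fun t => (hE t).continuousAt
  have hhc : Continuous h := continuous_iff_continuousAt.2 fun t => (hh t).continuousAt
  have hcs : HasCompactSupport h := hc.mono fun t ht hz => ht (by simp [hdef, hz])
  have hcs' : HasCompactSupport fun t => (h t : ℂ) := hcs.comp_left Complex.ofReal_zero
  have hmul : ∀ t, h t * (1 - t ^ p) = η t := by
    intro t
    by_cases ht : t ∈ nonstationarySet δ
    · exact div_mul_cancel₀ _ (one_sub_pow_ne_zero hp hδ0 hδ1 ht)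
    · have : η t = 0 := Function.notMem_support.1 fun h => ht (hs h)
      simp [hdef, this]
  have hbi : Integrable fun t : ℝ => K * (1 + t ^ 2)⁻¹ := integrable_inv_one_add_sq.const_mul K
  have hbd : ∀ t, ‖(h' t : ℂ) * E t‖ ≤ K * (1 + t ^ 2)⁻¹ := fun t => by
    rw [norm_mul, norm_e, mul_one, Complex.norm_real]; exact hb t
  have hmeas : Measurable h' := by
    rw [show h' = deriv h from funext fun t => (hh t).deriv.symm]
    exact measurable_deriv h
  have hi2 : Integrable fun t => (h' t : ℂ) * E t :=
    hbi.mono' ((Complex.measurable_ofReal.comp hmeas).mul hEc.measurable).aestronglyMeasurable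
      (Filter.Eventually.of_forall hbd)
  have key := integral_mul_deriv_eq_deriv_mul_of_integrable
    (u := fun t => (h t : ℂ)) (v := E) (u' := fun t => (h' t : ℂ))
    (v' := fun t => 2 * Real.pi * Complex.I * (l * (1 - t ^ p) : ℝ) * E t)
    (fun t _ => (hh t).ofReal_comp) (fun t _ => hE t)
    (Continuous.integrable_of_hasCompactSupport
      (Continuous.mul (by fun_prop) (by fun_prop)) hcs'.mul_right) hi2
    (Continuous.integrable_of_hasCompactSupport
      (Continuous.mul (by fun_prop) hEc) hcs'.mul_right)
  have hrew : ∀ t, (h t : ℂ) * (2 * Real.pi * Complex.I * (l * (1 - t ^ p) : ℝ) * E t)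
      = 2 * Real.pi * Complex.I * l * (E t * η t) := fun t => by
    rw [← hmul t]; push_cast; ring
  simp_rw [hrew] at key
  rw [integral_const_mul] at key
  have hle : ‖∫ t, (h' t : ℂ) * E t‖ ≤ K * Real.pi := by
    refine (norm_integral_le_of_norm_le hbi (Filter.Eventually.of_forall hbd)).trans_eq ?_
    rw [integral_const_mul, integral_univ_inv_one_add_sq]
  have hn := congrArg norm key
  rw [norm_neg, norm_mul] at hn
  have hnorm : ‖2 * (Real.pi : ℂ) * Complex.I * l‖ = 2 * Real.pi * |l| := by
    simp [abs_of_pos Real.pi_pos]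
  rw [hnorm] at hn
  rw [le_div_iff₀ (abs_pos.2 hl)]
  have hnn := norm_nonneg (∫ t, E t * (η t : ℂ))
  have : Real.pi * (‖∫ t, E t * (η t : ℂ)‖ * |l|) ≤ Real.pi * K := by
    nlinarith [mul_nonneg Real.pi_pos.le (mul_nonneg hnn (abs_nonneg l))]
  exact le_of_mul_le_mul_left this Real.pi_pos

/-- **Lemma (Non-stationary regime).** Fix `k ≥ 3`, `δ ∈ (0,1)` and `A > 0`. There is a
constant `C > 0` (depending only on `k`, `δ`, `A`) such that for all distinct positive
integers `n, m`, with `φ_{n,m}(x) = (n−m)(x − (n+m)xᵏ/k)` and `x₀ = (n+m)^{−1/(k−1)}`: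
if `θ : ℝ → [0,1]` is smooth, supported in `[−x₀/2, x₀(1−δ/2)] ∪ [x₀(1+δ/2), 2]`, with
`|θ'(x)| ≤ A/x₀` for all `x`, then `|∫ e(φ_{n,m}(x)) θ(x) dx| ≤ C/|n−m|`. -/
theorem stmt5 (k : ℕ) (hk : 3 ≤ k) (δ : ℝ) (hδ0 : 0 < δ) (hδ1 : δ < 1)
    (A : ℝ) (hA : 0 < A) :
    ∃ C > 0, ∀ n m : ℕ, 0 < n → 0 < m → n ≠ m →
      let x₀ : ℝ := ((n:ℝ) + m) ^ (-(1 / ((k:ℝ) - 1)))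
      ∀ θ : ℝ → ℝ, ContDiff ℝ (⊤ : ℕ∞) θ → (∀ x, θ x ∈ Set.Icc (0:ℝ) 1) →
        Function.support θ ⊆
          Set.Icc (-x₀ / 2) (x₀ * (1 - δ / 2)) ∪ Set.Icc (x₀ * (1 + δ / 2)) 2 →
        (∀ x, |deriv θ x| ≤ A / x₀) →
        ‖∫ x : ℝ, e (((n:ℝ) - m) * (x - ((n:ℝ) + m) * x^k / k)) * (θ x : ℂ)‖
          ≤ C / |(n:ℝ) - m| := by
  obtain ⟨p, rfl⟩ : ∃ p, k = p + 1 := ⟨k - 1, by omega⟩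
  have hp : 2 ≤ p := by omega
  refine ⟨A * (4 / δ) + p * (4 / δ) ^ 2, by positivity, ?_⟩
  intro n m hn hm hnm x₀ θ hθ hθ01 hsupp hθ'
  have hN : (0:ℝ) < (n:ℝ) + m := by positivity
  have hx : 0 < x₀ := Real.rpow_pos_of_pos hN _
  have hxp : ((n:ℝ) + m) * x₀ ^ p = 1 := by
    have hp0 : (p:ℝ) ≠ 0 := by positivity
    rw [← Real.rpow_natCast, ← Real.rpow_mul hN.le]
    push_cast
    rw [add_sub_cancel_right, neg_mul, one_div_mul_cancel hp0, Real.rpow_neg_one,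
      mul_inv_cancel₀ hN.ne']
  have hd : Differentiable ℝ θ := hθ.differentiable (by simp)
  have hderiv : ∀ t, HasDerivAt (fun t => θ (x₀ * t)) (deriv θ (x₀ * t) * x₀) t := fun t =>
    ((hd (x₀ * t)).hasDerivAt.comp t ((hasDerivAt_id' t).const_mul x₀)).congr_deriv
      (by rw [mul_one])
  have hS : ∀ t, θ (x₀ * t) ≠ 0 → t ∈ nonstationarySet δ ∧ x₀ * t ≤ 2 + x₀ := by
    intro t ht
    rcases hsupp ht with ⟨h1, h2⟩ | ⟨h1, h2⟩
    · have h3 := le_of_mul_le_mul_left h2 hx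
      have h4 : -1 / 2 ≤ t := le_of_mul_le_mul_left (by linarith) hx
      exact ⟨Or.inl ⟨h4, h3⟩, by nlinarith⟩
    · exact ⟨Or.inr (le_of_mul_le_mul_left h1 hx), by linarith⟩
  have hmain := norm_integral_e_phase_mul_le hp hδ0 hδ1 (A := A) (η := fun t => θ (x₀ * t))
    (l := ((n:ℝ) - m) * x₀) (fun t => (hderiv t).differentiableAt)
    (fun t => abs_le.2 ⟨by linarith [(hθ01 (x₀ * t)).1], (hθ01 (x₀ * t)).2⟩)
    (fun t ht => (hS t ht).1)
    (fun t => by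
      rw [(hderiv t).deriv, abs_mul, abs_of_pos hx, ← le_div_iff₀ hx]
      exact hθ' _)
    (HasCompactSupport.intro (isCompact_Icc (a := -1 / 2) (b := (2 + x₀) / x₀)) fun t ht => by
      by_contra hne
      obtain ⟨h1, h2⟩ := hS t hne
      refine ht ⟨?_, by rw [le_div_iff₀ hx]; linarith⟩
      rcases h1 with h1 | h1
      · exact h1.1
      · have : 1 + δ / 2 ≤ t := h1
        linarith)
    (mul_ne_zero (sub_ne_zero.2 (by exact_mod_cast hnm)) hx.ne')
  have hphase : ∀ t : ℝ, ((n:ℝ) - m) * x₀ * (t - t ^ (p + 1) / ((p + 1 : ℕ) : ℝ))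
      = ((n:ℝ) - m) * (x₀ * t - ((n:ℝ) + m) * (x₀ * t) ^ (p + 1) / ((p + 1 : ℕ) : ℝ)) := by
    intro t
    have : ((n:ℝ) + m) * (x₀ * t) ^ (p + 1) = x₀ * t ^ (p + 1) := by
      calc _ = (((n:ℝ) + m) * x₀ ^ p) * (x₀ * t ^ (p + 1)) := by ring
        _ = _ := by rw [hxp, one_mul]
    rw [this]; ring
  simp_rw [hphase] at hmain
  rw [Measure.integral_comp_mul_left (fun x : ℝ =>
    e (((n:ℝ) - m) * (x - ((n:ℝ) + m) * x ^ (p + 1) / ((p + 1 : ℕ) : ℝ))) * (θ x : ℂ)) x₀,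
    norm_smul, Real.norm_eq_abs, abs_abs, abs_mul, abs_inv, abs_of_pos hx, inv_mul_le_iff₀ hx] at hmain
  refine hmain.trans_eq ?_
  field_simp
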